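/- arXiv:1609.02609 — 4 statements merged into one kernel-verified Lean document; each statement's English description precedes it below -/
import Mathlib

section
/- Let n ≥ 2 and let X be a nonzero real symmetric positive semidefinite n×n matrix. Then X has rank one if and only if there exists a real n×(n−1) matrix V with orthonormal columns (VᵀV = I_{n−1}) such that Vᵀ X V = 0. -/
open Matrix

/-- The kernel of a real matrix has an orthonormal basis, arranged as the columns of a matrix. -/
theorem exists_orthonormal_columns_mul_eq_zero {m n k : ℕ} (A : Matrix (Fin m) (Fin n) ℝ)
    (hk : A.rank + k = n) :
    ∃ V : Matrix (Fin n) (Fin k) ℝ, Vᵀ * V = 1 ∧ A * V = 0 := by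
  have hker : Module.finrank ℝ (LinearMap.ker A.toEuclideanLin) = k := by
    have h := A.toEuclideanLin.finrank_range_add_finrank_ker
    rw [finrank_euclideanSpace_fin, toEuclideanLin_eq_toLin_orthonormal, ← rank_eq_finrank_range_toLin A
      (EuclideanSpace.basisFun (Fin m) ℝ).toBasis (EuclideanSpace.basisFun (Fin n) ℝ).toBasis] at h
    rw [toEuclideanLin_eq_toLin_orthonormal]
    exact Nat.add_left_cancel (h.trans hk.symm)
  let b := (stdOrthonormalBasis ℝ (LinearMap.ker A.toEuclideanLin)).reindex (finCongr hker)
  refine ⟨of fun i j => (b j : EuclideanSpace ℝ (Fin n)) i, ?_, ?_⟩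
  · ext i j
    have h := orthonormal_iff_ite.mp b.orthonormal j i
    rw [Submodule.coe_inner, PiLp.inner_apply] at h
    simpa [mul_apply, one_apply, eq_comm] using h
  · ext i j
    have h := congrArg (fun v => v i) (LinearMap.mem_ker.mp (b j).2)
    rw [toLpLin_apply] at h
    exact h

/-- For positive semidefinite `X`, the congruence `Vᵀ X V` vanishes only if `X V` does. -/
theorem Matrix.PosSemidef.mul_eq_zero_of_transpose_mul_mul_eq_zero {m n : Type*} [Fintype m]
    [Fintype n] {X : Matrix m m ℝ} (hX : X.PosSemidef) {V : Matrix m n ℝ}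
    (h : Vᵀ * X * V = 0) : X * V = 0 := by
  ext i j
  have hj : V.col j ⬝ᵥ (X *ᵥ V.col j) = 0 := by
    have hjj := congrFun₂ h j j
    rwa [Matrix.mul_assoc] at hjj
  exact congrFun ((hX.dotProduct_mulVec_zero_iff (V.col j)).mp hj) i

/-- Let `n ≥ 2` and let `X` be a nonzero real symmetric positive semidefinite `n×n` matrix.
Then `X` has rank one if and only if there exists a real `n×(n−1)` matrix `V` with
orthonormal columns (`VᵀV = I`) such that `Vᵀ X V = 0`. -/
theorem stmt_2 {n : ℕ} (hn : 2 ≤ n) (X : Matrix (Fin n) (Fin n) ℝ)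
    (hX : X.PosSemidef) (hX0 : X ≠ 0) :
    X.rank = 1 ↔
      ∃ V : Matrix (Fin n) (Fin (n - 1)) ℝ, Vᵀ * V = 1 ∧ Vᵀ * X * V = 0 := by
  constructor
  · intro h
    obtain ⟨V, hV, hXV⟩ := exists_orthonormal_columns_mul_eq_zero (k := n - 1) X (by lia)
    exact ⟨V, hV, by rw [Matrix.mul_assoc, hXV, Matrix.mul_zero]⟩
  · rintro ⟨V, hV, hVXV⟩
    have hle := rank_add_rank_le_card_of_mul_eq_zero
      (hX.mul_eq_zero_of_transpose_mul_mul_eq_zero hVXV)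
    rw [← rank_transpose_mul_self V, hV, rank_one, Fintype.card_fin, Fintype.card_fin] at hle
    have hne : X.rank ≠ 0 := by
      rwa [Ne, rank, Submodule.finrank_eq_zero, LinearMap.range_eq_bot, ← toLin'_apply',
        LinearEquiv.map_eq_zero_iff]
    lia
end

section
/- Let n ≥ 2, let X and Y be real symmetric positive semidefinite n×n matrices with X ≠ 0, and let V be a real n×(n−1) matrix with orthonormal columns (VᵀV = I_{n−1}) such that Vᵀ X V = 0 and Vᵀ Y V = 0. Then there exists a real number α ≥ 0 such that Y = α·X. -/
open Matrix

/-- If `VᵀMV = 0` with `M` positive semidefinite, then already `MV = 0`, hence `VᵀM = 0`. -/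
lemma Matrix.PosSemidef.transpose_mul_eq_zero {m n : Type*} [Fintype m] [Fintype n]
    {M : Matrix n n ℝ} (hM : M.PosSemidef) {V : Matrix n m ℝ} (hMV : Vᵀ * M * V = 0) :
    Vᵀ * M = 0 := by
  classical
  have hMV' : M * V = 0 := by
    refine Matrix.ext_of_mulVec_single fun j => ?_
    rw [← mulVec_mulVec, zero_mulVec, ← hM.dotProduct_mulVec_zero_iff, star_trivial,
      mulVec_mulVec, ← vecMul_transpose, ← dotProduct_mulVec, mulVec_mulVec, ← Matrix.mul_assoc,
      hMV, zero_mulVec, dotProduct_zero]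
  have hMt : Mᵀ = M := by simpa using hM.isHermitian.eq
  rw [← hMt, ← transpose_mul, hMV', transpose_zero]

/-- The kernel of the transpose of an `n × (n - 1)` matrix with orthonormal columns is a line. -/
lemma Matrix.exists_span_ker_transpose {m n : Type*} [Fintype m] [Fintype n] [DecidableEq m]
    {V : Matrix n m ℝ} (hV : Vᵀ * V = 1) (hcard : Fintype.card m + 1 = Fintype.card n) :
    ∃ u : n → ℝ, u ≠ 0 ∧ ∀ w : n → ℝ, Vᵀ *ᵥ w = 0 → ∃ c : ℝ, c • u = w := by
  have hsurj : LinearMap.range Vᵀ.mulVecLin = ⊤ :=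
    LinearMap.range_eq_top.2 fun y => ⟨V *ᵥ y, by
      rw [mulVecLin_apply, mulVec_mulVec, hV, one_mulVec]⟩
  have hdim : Module.finrank ℝ (LinearMap.ker Vᵀ.mulVecLin) = 1 := by
    have h := Vᵀ.mulVecLin.finrank_range_add_finrank_ker
    rw [hsurj, finrank_top, Module.finrank_fintype_fun_eq_card,
      Module.finrank_fintype_fun_eq_card] at h
    lia
  obtain ⟨u, hu, hspan⟩ := finrank_eq_one_iff'.1 hdim
  refine ⟨u, by simpa using hu, fun w hw => ?_⟩
  obtain ⟨c, hc⟩ := hspan ⟨w, hw⟩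
  exact ⟨c, congrArg Subtype.val hc⟩

/-- A positive semidefinite matrix whose columns all lie on the line through `u` is a nonnegative
multiple of `u uᵀ`. -/
lemma Matrix.PosSemidef.exists_eq_smul_vecMulVec {n : Type*} [Fintype n]
    {M : Matrix n n ℝ} (hM : M.PosSemidef) {u : n → ℝ} (hu : u ≠ 0)
    (hcol : ∀ j, ∃ c : ℝ, c • u = M.col j) :
    ∃ a : ℝ, 0 ≤ a ∧ M = a • vecMulVec u u := by
  choose c hc using hcol
  have hentry (i j) : M i j = c j * u i := (congrFun (hc j) i).symm
  obtain ⟨k, hk⟩ := Function.ne_iff.1 hu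
  have hk : u k ≠ 0 := hk
  have hcoef (j) : c j = c k / u k * u j := by
    have h : M k j = M j k := by simpa using hM.isHermitian.apply j k
    rw [hentry, hentry] at h
    field_simp
    linarith
  refine ⟨c k / u k, ?_, ?_⟩
  · have h : 0 ≤ M k k := hM.diag_nonneg
    rw [hentry] at h
    rw [← mul_div_mul_right _ _ hk]
    exact div_nonneg h (mul_self_nonneg _)
  · ext i j
    rw [hentry, hcoef, smul_apply, vecMulVec_apply, smul_eq_mul]
    ring

/-- Let `n ≥ 2`, let `X` and `Y` be real symmetric positive semidefinite `n×n` matrices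
with `X ≠ 0`, and let `V` be a real `n×(n−1)` matrix with orthonormal columns (`VᵀV = I`)
such that `Vᵀ X V = 0` and `Vᵀ Y V = 0`. Then there exists `α ≥ 0` with `Y = α·X`. -/
theorem stmt_6 {n : ℕ} (hn : 2 ≤ n) (X Y : Matrix (Fin n) (Fin n) ℝ)
    (hX : X.PosSemidef) (hY : Y.PosSemidef) (hX0 : X ≠ 0)
    (V : Matrix (Fin n) (Fin (n - 1)) ℝ) (hV : Vᵀ * V = 1)
    (hXV : Vᵀ * X * V = 0) (hYV : Vᵀ * Y * V = 0) :
    ∃ α : ℝ, 0 ≤ α ∧ Y = α • X := by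
  obtain ⟨u, hu, hspan⟩ := exists_span_ker_transpose hV (by simp only [Fintype.card_fin]; lia)
  have hrank {M : Matrix (Fin n) (Fin n) ℝ} (hM : M.PosSemidef) (hMV : Vᵀ * M * V = 0) :
      ∃ a : ℝ, 0 ≤ a ∧ M = a • vecMulVec u u :=
    hM.exists_eq_smul_vecMulVec hu fun j => hspan _ <| by
      rw [← mulVec_single_one, mulVec_mulVec, hM.transpose_mul_eq_zero hMV, zero_mulVec]
  obtain ⟨a, ha, rfl⟩ := hrank hX hXV
  obtain ⟨b, hb, rfl⟩ := hrank hY hYV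
  have ha0 : a ≠ 0 := left_ne_zero_of_smul hX0
  exact ⟨b / a, div_nonneg hb ha, by rw [smul_smul, div_mul_cancel₀ b ha0]⟩
end

section
/- Let S and F be real symmetric n×n matrices with S positive semidefinite, F negative semidefinite, and trace(S·F) = 0, and let δ ≥ 0 be a real number. Then the positive part of S + δ·F equals S, i.e. [S + δF]₊ = S. -/
open Matrix

/-- The positive part `[M]₊` of a real symmetric matrix `M = Q·diag(λ)·Qᵀ` is
`Q·diag(max(λ,0))·Qᵀ` (and `0` by convention for non-symmetric matrices). -/
noncomputable def matPosPart {n : ℕ} (M : Matrix (Fin n) (Fin n) ℝ) :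
    Matrix (Fin n) (Fin n) ℝ :=
  if hM : M.IsHermitian then
    (hM.eigenvectorUnitary : Matrix (Fin n) (Fin n) ℝ) *
      Matrix.diagonal (fun i => max (hM.eigenvalues i) 0) *
        star (hM.eigenvectorUnitary : Matrix (Fin n) (Fin n) ℝ)
  else 0

open scoped MatrixOrder in
/-- Positive semidefinite matrices whose product has trace zero annihilate each other. -/
theorem Matrix.PosSemidef.mul_eq_zero_of_trace_mul_eq_zero {m : Type*} [Fintype m]
    {A B : Matrix m m ℝ} (hA : A.PosSemidef) (hB : B.PosSemidef) (h : (A * B).trace = 0) :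
    A * B = 0 := by
  classical
  obtain ⟨X, rfl⟩ := CStarAlgebra.nonneg_iff_eq_star_mul_self.mp hA.nonneg
  obtain ⟨Y, rfl⟩ := CStarAlgebra.nonneg_iff_eq_star_mul_self.mp hB.nonneg
  simp only [star_eq_conjTranspose] at h ⊢
  have hXY : X * Yᴴ = 0 := by
    rw [← trace_conjTranspose_mul_self_eq_zero_iff, ← h, conjTranspose_mul,
      conjTranspose_conjTranspose, Matrix.mul_assoc, trace_mul_comm]
    simp only [Matrix.mul_assoc]
  rw [Matrix.mul_assoc, ← Matrix.mul_assoc X, hXY, Matrix.zero_mul, Matrix.mul_zero]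

/-- The spectral positive part agrees with the one from the continuous functional calculus. -/
theorem matPosPart_eq_posPart {n : ℕ} {M : Matrix (Fin n) (Fin n) ℝ} (hM : M.IsHermitian) :
    matPosPart M = M⁺ := by
  rw [CFC.posPart_def, cfcₙ_eq_cfc, hM.cfc_eq, Matrix.IsHermitian.cfc, matPosPart, dif_pos hM]
  rfl

/-- Let `S` and `F` be real symmetric `n×n` matrices with `S` positive semidefinite, `F`
negative semidefinite, `trace(S·F) = 0`, and let `δ ≥ 0`. Then `[S + δF]₊ = S`. -/
theorem stmt_8 {n : ℕ} (S F : Matrix (Fin n) (Fin n) ℝ)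
    (hS : S.PosSemidef) (hF : (-F).PosSemidef) (htr : (S * F).trace = 0)
    (δ : ℝ) (hδ : 0 ≤ δ) :
    matPosPart (S + δ • F) = S := by
  have hG : (δ • -F).PosSemidef := hF.smul hδ
  have hmul : S * (δ • -F) = 0 :=
    hS.mul_eq_zero_of_trace_mul_eq_zero hG (by simp [htr])
  have hsub : S + δ • F = S - δ • -F := by simp
  rw [hsub, matPosPart_eq_posPart (hS.isHermitian.sub hG.isHermitian)]
  open scoped MatrixOrder in
  exact (CFC.posPart_negPart_unique rfl hmul hS.nonneg hG.nonneg).1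
end

section
/- Let ξ > 0, L ≥ 0, δ > 0 and e ≥ 0 be real numbers, and let S, S*, F, F* be real symmetric n×n matrices satisfying: (i) trace((S − S*)·(F − F*)) ≤ −ξ·e², (ii) ‖F − F*‖_F ≤ L·e, and (iii) S* = [S* + δ·F*]₊. Then ‖[S + δF]₊ − S*‖_F² ≤ ‖S − S*‖_F² − (2ξδ − δ²L²)·e². -/
open Matrix

/-- The Frobenius norm `‖A‖_F = √trace(AᵀA)`. -/
noncomputable def frobNorm {n : ℕ} (A : Matrix (Fin n) (Fin n) ℝ) : ℝ :=
  Real.sqrt (Aᵀ * A).trace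

open scoped MatrixOrder Matrix.Norms.L2Operator in
theorem Matrix.PosSemidef.trace_mul_nonneg_real {m : Type*} [Fintype m] [DecidableEq m]
    {A B : Matrix m m ℝ} (hA : A.PosSemidef) (hB : B.PosSemidef) : 0 ≤ (A * B).trace := by
  obtain ⟨C, rfl⟩ := CStarAlgebra.nonneg_iff_eq_star_mul_self.mp hA.nonneg
  rw [Matrix.mul_assoc, Matrix.trace_mul_comm]
  exact (hB.mul_mul_conjTranspose_same C).trace_nonneg

theorem frobNorm_sq {n : ℕ} (A : Matrix (Fin n) (Fin n) ℝ) :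
    frobNorm A ^ 2 = (Aᵀ * A).trace :=
  Real.sq_sqrt (by
    simpa [Matrix.conjTranspose_eq_transpose_of_trivial] using
      (Matrix.posSemidef_conjTranspose_mul_self A).trace_nonneg)

theorem Matrix.IsHermitian.frobNorm_sq {n : ℕ} {A : Matrix (Fin n) (Fin n) ℝ}
    (hA : A.IsHermitian) : frobNorm A ^ 2 = (A * A).trace := by
  rw [_root_.frobNorm_sq, ← Matrix.conjTranspose_eq_transpose_of_trivial, hA.eq]

/-- The positive part `P` of `M` satisfies `0 ≤ P`, `M ≤ P` and `P * (P - M) = 0`. -/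
theorem matPosPart_spec {n : ℕ} {M : Matrix (Fin n) (Fin n) ℝ} (hM : M.IsHermitian) :
    (matPosPart M).PosSemidef ∧ (matPosPart M - M).PosSemidef ∧
      matPosPart M * (matPosPart M - M) = 0 := by
  have hP : matPosPart M = (hM.eigenvectorUnitary : Matrix (Fin n) (Fin n) ℝ) *
      Matrix.diagonal (fun i => max (hM.eigenvalues i) 0) *
        star (hM.eigenvectorUnitary : Matrix (Fin n) (Fin n) ℝ) :=
    dif_pos hM
  have hU : star (hM.eigenvectorUnitary : Matrix (Fin n) (Fin n) ℝ) *
      (hM.eigenvectorUnitary : Matrix (Fin n) (Fin n) ℝ) = 1 :=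
    Unitary.coe_star_mul_self _
  have hM' : M = (hM.eigenvectorUnitary : Matrix (Fin n) (Fin n) ℝ) *
      Matrix.diagonal hM.eigenvalues *
        star (hM.eigenvectorUnitary : Matrix (Fin n) (Fin n) ℝ) := by
    simpa [Unitary.conjStarAlgAut_apply, Function.comp_def] using hM.spectral_theorem
  have hN : matPosPart M - M = (hM.eigenvectorUnitary : Matrix (Fin n) (Fin n) ℝ) *
      Matrix.diagonal (fun i => max (hM.eigenvalues i) 0 - hM.eigenvalues i) *
        star (hM.eigenvectorUnitary : Matrix (Fin n) (Fin n) ℝ) := by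
    rw [← Matrix.diagonal_sub, mul_sub, sub_mul, ← hP, ← hM']
  refine ⟨?_, ?_, ?_⟩
  · rw [hP]
    exact (Matrix.PosSemidef.diagonal fun i => le_max_right _ _).mul_mul_conjTranspose_same _
  · rw [hN]
    exact (Matrix.PosSemidef.diagonal fun i =>
      sub_nonneg.2 (le_max_left _ _)).mul_mul_conjTranspose_same _
  · rw [hN, hP]
    generalize (hM.eigenvectorUnitary : Matrix (Fin n) (Fin n) ℝ) = U at hU
    have hD : Matrix.diagonal (fun i => max (hM.eigenvalues i) 0) *
        Matrix.diagonal (fun i => max (hM.eigenvalues i) 0 - hM.eigenvalues i) = 0 := by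
      rw [Matrix.diagonal_mul_diagonal, Matrix.diagonal_eq_zero]
      funext i
      rcases le_total (hM.eigenvalues i) 0 with h | h <;> simp [h]
    calc _ = U * (Matrix.diagonal (fun i => max (hM.eigenvalues i) 0) * (star U * U) *
          Matrix.diagonal (fun i => max (hM.eigenvalues i) 0 - hM.eigenvalues i)) * star U := by
          simp only [Matrix.mul_assoc]
      _ = 0 := by rw [hU, Matrix.mul_one, hD, Matrix.mul_zero, Matrix.zero_mul]

/-- The positive part is nonexpansive in the Frobenius norm. -/
theorem frobNorm_matPosPart_sub_sq_le {n : ℕ} {A B : Matrix (Fin n) (Fin n) ℝ}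
    (hA : A.IsHermitian) (hB : B.IsHermitian) :
    frobNorm (matPosPart A - matPosPart B) ^ 2 ≤ frobNorm (A - B) ^ 2 := by
  obtain ⟨hP, hN, hPN⟩ := matPosPart_spec hA
  obtain ⟨hQ, hK, hQK⟩ := matPosPart_spec hB
  rw [(hP.isHermitian.sub hQ.isHermitian).frobNorm_sq, (hA.sub hB).frobNorm_sq]
  generalize matPosPart A = P at *
  generalize matPosPart B = Q at *
  obtain ⟨N, rfl⟩ : ∃ N, A = P - N := ⟨P - A, by abel⟩
  obtain ⟨K, rfl⟩ : ∃ K, B = Q - K := ⟨Q - B, by abel⟩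
  simp only [sub_sub_cancel] at hN hK hPN hQK
  have hPK := hP.trace_mul_nonneg_real hK
  have hQN := hQ.trace_mul_nonneg_real hN
  have hPN' := congrArg Matrix.trace hPN
  have hQK' := congrArg Matrix.trace hQK
  have hNK : 0 ≤ ((N - K) * (N - K)).trace := by
    have hH := hN.isHermitian.sub hK.isHermitian
    exact hH.frobNorm_sq ▸ sq_nonneg _
  simp only [Matrix.mul_sub, Matrix.sub_mul, Matrix.trace_sub, Matrix.trace_zero] at *
  linarith [Matrix.trace_mul_comm N P, Matrix.trace_mul_comm N Q, Matrix.trace_mul_comm K P,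
    Matrix.trace_mul_comm K Q]

/-- One-step decrease estimate of the extended Uzawa algorithm: if
`⟨S − S*, F − F*⟩ ≤ −ξ·e²`, `‖F − F*‖_F ≤ L·e` and `S* = [S* + δF*]₊`, then
`‖[S + δF]₊ − S*‖_F² ≤ ‖S − S*‖_F² − (2ξδ − δ²L²)·e²`. -/
theorem stmt_11 {n : ℕ} (ξ L δ e : ℝ) (hξ : 0 < ξ) (hL : 0 ≤ L) (hδ : 0 < δ)
    (he : 0 ≤ e) (S Sstar F Fstar : Matrix (Fin n) (Fin n) ℝ)
    (hS : S.IsHermitian) (hSstar : Sstar.IsHermitian)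
    (hF : F.IsHermitian) (hFstar : Fstar.IsHermitian)
    (h1 : ((S - Sstar) * (F - Fstar)).trace ≤ -ξ * e ^ 2)
    (h2 : frobNorm (F - Fstar) ≤ L * e)
    (h3 : matPosPart (Sstar + δ • Fstar) = Sstar) :
    frobNorm (matPosPart (S + δ • F) - Sstar) ^ 2 ≤
      frobNorm (S - Sstar) ^ 2 - (2 * ξ * δ - δ ^ 2 * L ^ 2) * e ^ 2 := by
  have hA : (S + δ • F).IsHermitian := hS.add (hF.smul (IsSelfAdjoint.all δ))
  have hB : (Sstar + δ • Fstar).IsHermitian := hSstar.add (hFstar.smul (IsSelfAdjoint.all δ))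
  have hle := frobNorm_matPosPart_sub_sq_le hA hB
  have hF2 : frobNorm (F - Fstar) ^ 2 ≤ (L * e) ^ 2 :=
    pow_le_pow_left₀ (Real.sqrt_nonneg _) h2 2
  have hsplit : S + δ • F - (Sstar + δ • Fstar) = (S - Sstar) + δ • (F - Fstar) := by
    rw [smul_sub]; abel
  have hexpand : frobNorm (S + δ • F - (Sstar + δ • Fstar)) ^ 2 =
      frobNorm (S - Sstar) ^ 2 + 2 * δ * ((S - Sstar) * (F - Fstar)).trace +
        δ ^ 2 * frobNorm (F - Fstar) ^ 2 := by
    rw [(hA.sub hB).frobNorm_sq, (hS.sub hSstar).frobNorm_sq, (hF.sub hFstar).frobNorm_sq, hsplit]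
    generalize S - Sstar = X
    generalize F - Fstar = Y
    simp only [Matrix.mul_add, Matrix.add_mul, Matrix.smul_mul, Matrix.mul_smul, Matrix.trace_add,
      Matrix.trace_smul, smul_eq_mul, Matrix.trace_mul_comm Y X]
    ring
  rw [h3, hexpand] at hle
  have h1' := mul_le_mul_of_nonneg_left h1 (by positivity : 0 ≤ 2 * δ)
  have hF2' := mul_le_mul_of_nonneg_left hF2 (sq_nonneg δ)
  linarith
end
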